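/- arXiv:2008.03442 — 12 statements merged into one kernel-verified Lean document; each statement's English description precedes it below -/
import Mathlib

section
/- Let H : E × E × ℝ → ℝ be C¹ with (∂H/∂u)(x,p,u) ≥ λ for some λ > 0 and all (x,p,u), and let z : I → E × E × ℝ be a solution of the contact Hamiltonian ODE associated to H on an interval I containing 0. Then: (i) for every t ∈ I with t ≥ 0, |H(z(t))| ≤ e^{−λt} · |H(z(0))|; (ii) H never changes sign along the orbit, i.e. for every t ∈ I, H(z(t)) > 0 iff H(z(0)) > 0, H(z(t)) = 0 iff H(z(0)) = 0, and H(z(t)) < 0 iff H(z(0)) < 0. -/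
open scoped RealInnerProductSpace

noncomputable def pgradX {n : ℕ}
    (H : EuclideanSpace ℝ (Fin n) × EuclideanSpace ℝ (Fin n) × ℝ → ℝ)
    (z : EuclideanSpace ℝ (Fin n) × EuclideanSpace ℝ (Fin n) × ℝ) :
    EuclideanSpace ℝ (Fin n) :=
  gradient (fun x => H (x, z.2.1, z.2.2)) z.1

noncomputable def pgradP {n : ℕ}
    (H : EuclideanSpace ℝ (Fin n) × EuclideanSpace ℝ (Fin n) × ℝ → ℝ)
    (z : EuclideanSpace ℝ (Fin n) × EuclideanSpace ℝ (Fin n) × ℝ) :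
    EuclideanSpace ℝ (Fin n) :=
  gradient (fun p => H (z.1, p, z.2.2)) z.2.1

noncomputable def pderivU {n : ℕ}
    (H : EuclideanSpace ℝ (Fin n) × EuclideanSpace ℝ (Fin n) × ℝ → ℝ)
    (z : EuclideanSpace ℝ (Fin n) × EuclideanSpace ℝ (Fin n) × ℝ) : ℝ :=
  deriv (fun u => H (z.1, z.2.1, u)) z.2.2

/-- `z = (x,p,u)` solves the contact Hamiltonian ODE associated to `H` on `I`. -/
def IsContactSol {n : ℕ}
    (H : EuclideanSpace ℝ (Fin n) × EuclideanSpace ℝ (Fin n) × ℝ → ℝ)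
    (I : Set ℝ) (x p : ℝ → EuclideanSpace ℝ (Fin n)) (u : ℝ → ℝ) : Prop :=
  ∀ t ∈ I,
    HasDerivAt x (pgradP H (x t, p t, u t)) t ∧
    HasDerivAt p (-pgradX H (x t, p t, u t) - pderivU H (x t, p t, u t) • p t) t ∧
    HasDerivAt u (⟪pgradP H (x t, p t, u t), p t⟫ - H (x t, p t, u t)) t

/-- The solution of the scalar linear equation `h' = -a h` as an exponential of an integral. -/
theorem eq_exp_neg_integral_mul_of_hasDerivAt {h a : ℝ → ℝ} {t₀ t : ℝ}
    (ha : ContinuousOn a (Set.uIcc t₀ t))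
    (hh : ∀ s ∈ Set.uIcc t₀ t, HasDerivAt h (-(a s * h s)) s) :
    h t = Real.exp (-∫ s in t₀..t, a s) * h t₀ := by
  set b : ℝ → ℝ := Set.IccExtend inf_le_sup ((Set.uIcc t₀ t).domRestrict a) with hb
  have hbc : Continuous b := ha.domRestrict.Icc_extend'
  have hba : ∀ s ∈ Set.uIcc t₀ t, b s = a s := fun s hs =>
    Set.IccExtend_of_mem inf_le_sup _ hs
  have hint : ∫ s in t₀..t, a s = ∫ s in t₀..t, b s :=
    intervalIntegral.integral_congr fun s hs => (hba s hs).symm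
  have hconst := (convex_uIcc t₀ t).norm_image_sub_le_of_norm_hasDerivWithin_le (C := 0)
    (f := fun s => Real.exp (∫ r in t₀..s, b r) * h s) (f' := fun _ => 0)
    (fun s hs => by
      have h1 := ((hbc.integral_hasStrictDerivAt t₀ s).hasDerivAt.exp.mul (hh s hs))
      refine (h1.congr_deriv ?_).hasDerivWithinAt
      rw [hba s hs]
      ring)
    (fun s _ => by simp) Set.left_mem_uIcc Set.right_mem_uIcc
  simp only [intervalIntegral.integral_same, Real.exp_zero, one_mul, zero_mul] at hconst
  rw [norm_le_zero_iff, sub_eq_zero] at hconst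
  rw [hint, ← hconst, ← mul_assoc, ← Real.exp_add, neg_add_cancel, Real.exp_zero, one_mul]

section PartialDerivatives

variable {n : ℕ} {H : EuclideanSpace ℝ (Fin n) × EuclideanSpace ℝ (Fin n) × ℝ → ℝ}
  {z : EuclideanSpace ℝ (Fin n) × EuclideanSpace ℝ (Fin n) × ℝ}

theorem inner_pgradX (hH : DifferentiableAt ℝ H z) (v : EuclideanSpace ℝ (Fin n)) :
    ⟪pgradX H z, v⟫ = fderiv ℝ H z (v, 0, 0) := by
  have h1 : HasFDerivAt (fun x => H (x, z.2.1, z.2.2)) _ z.1 :=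
    HasFDerivAt.comp (g := H) z.1 hH.hasFDerivAt
      ((hasFDerivAt_id z.1).prodMk (hasFDerivAt_const (z.2.1, z.2.2) z.1))
  rw [pgradX, gradient, InnerProductSpace.toDual_symm_apply, h1.fderiv]
  simp [← Prod.mk_zero_zero]

theorem inner_pgradP (hH : DifferentiableAt ℝ H z) (v : EuclideanSpace ℝ (Fin n)) :
    ⟪pgradP H z, v⟫ = fderiv ℝ H z (0, v, 0) := by
  have h1 : HasFDerivAt (fun p => H (z.1, p, z.2.2)) _ z.2.1 :=
    HasFDerivAt.comp (g := H) z.2.1 hH.hasFDerivAt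
      ((hasFDerivAt_const z.1 z.2.1).prodMk
        ((hasFDerivAt_id z.2.1).prodMk (hasFDerivAt_const z.2.2 z.2.1)))
  rw [pgradP, gradient, InnerProductSpace.toDual_symm_apply, h1.fderiv]
  simp

theorem pderivU_eq_fderiv (hH : DifferentiableAt ℝ H z) :
    pderivU H z = fderiv ℝ H z (0, 0, 1) := by
  have h1 : HasDerivAt (fun u => H (z.1, z.2.1, u)) _ z.2.2 :=
    HasFDerivAt.comp_hasDerivAt (l := H) z.2.2 hH.hasFDerivAt
      ((hasDerivAt_const z.2.2 z.1).prodMk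
        ((hasDerivAt_const z.2.2 z.2.1).prodMk (hasDerivAt_id z.2.2)))
  exact h1.deriv

theorem fderiv_apply_eq_partials (hH : DifferentiableAt ℝ H z)
    (v w : EuclideanSpace ℝ (Fin n)) (r : ℝ) :
    fderiv ℝ H z (v, w, r) = ⟪pgradX H z, v⟫ + ⟪pgradP H z, w⟫ + r * pderivU H z := by
  rw [inner_pgradX hH, inner_pgradP hH, pderivU_eq_fderiv hH, ← smul_eq_mul, ← map_smul,
    ← map_add, ← map_add]
  simp

end PartialDerivatives

/-- Along a solution of the contact Hamiltonian ODE, `d/dt H = -(∂H/∂u) H`. -/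
theorem IsContactSol.hasDerivAt_hamiltonian {n : ℕ}
    {H : EuclideanSpace ℝ (Fin n) × EuclideanSpace ℝ (Fin n) × ℝ → ℝ}
    (hH : Differentiable ℝ H) {I : Set ℝ} {x p : ℝ → EuclideanSpace ℝ (Fin n)} {u : ℝ → ℝ}
    (hsol : IsContactSol H I x p u) {t : ℝ} (ht : t ∈ I) :
    HasDerivAt (fun s => H (x s, p s, u s))
      (-(pderivU H (x t, p t, u t) * H (x t, p t, u t))) t := by
  obtain ⟨hx, hp, hu⟩ := hsol t ht
  have h1 : HasDerivAt (fun s => H (x s, p s, u s)) _ t :=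
    HasFDerivAt.comp_hasDerivAt (l := H) t (hH (x t, p t, u t)).hasFDerivAt
      (hx.prodMk (hp.prodMk hu))
  refine h1.congr_deriv ?_
  rw [fderiv_apply_eq_partials (hH _), inner_sub_right, inner_neg_right, real_inner_smul_right,
    real_inner_comm (pgradX H _)]
  ring

theorem stmt_1 {n : ℕ} (hn : 1 ≤ n)
    (H : EuclideanSpace ℝ (Fin n) × EuclideanSpace ℝ (Fin n) × ℝ → ℝ) (hH : ContDiff ℝ 1 H)
    (lam : ℝ) (hlam : 0 < lam) (hmono : ∀ z, lam ≤ pderivU H z)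
    (I : Set ℝ) (hI : I.OrdConnected) (h0I : (0:ℝ) ∈ I)
    (x p : ℝ → EuclideanSpace ℝ (Fin n)) (u : ℝ → ℝ)
    (hsol : IsContactSol H I x p u) :
    (∀ t ∈ I, 0 ≤ t →
      |H (x t, p t, u t)| ≤ Real.exp (-(lam * t)) * |H (x 0, p 0, u 0)|) ∧
    (∀ t ∈ I,
      (0 < H (x t, p t, u t) ↔ 0 < H (x 0, p 0, u 0)) ∧
      (H (x t, p t, u t) = 0 ↔ H (x 0, p 0, u 0) = 0) ∧
      (H (x t, p t, u t) < 0 ↔ H (x 0, p 0, u 0) < 0)) := by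
  have hd : Differentiable ℝ H := hH.differentiable one_ne_zero
  have hsub : ∀ t ∈ I, Set.uIcc 0 t ⊆ I := fun t ht => hI.uIcc_subset h0I ht
  have hcont : ContinuousOn (fun s => pderivU H (x s, p s, u s)) I := by
    have hz : ContinuousOn (fun s => (x s, p s, u s)) I := fun s hs =>
      ((hsol s hs).1.continuousAt.prodMk ((hsol s hs).2.1.continuousAt.prodMk
        (hsol s hs).2.2.continuousAt)).continuousWithinAt
    have hU : pderivU H = fun z => fderiv ℝ H z (0, 0, 1) :=
      funext fun z => pderivU_eq_fderiv (hd z)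
    have hUc : Continuous (pderivU H) := by
      rw [hU]
      exact (hH.continuous_fderiv one_ne_zero).clm_apply continuous_const
    exact hUc.comp_continuousOn hz
  have key : ∀ t ∈ I, H (x t, p t, u t) =
      Real.exp (-∫ s in (0 : ℝ)..t, pderivU H (x s, p s, u s)) * H (x 0, p 0, u 0) :=
    fun t ht => eq_exp_neg_integral_mul_of_hasDerivAt
      (h := fun s => H (x s, p s, u s)) (hcont.mono (hsub t ht))
      fun s hs => hsol.hasDerivAt_hamiltonian hd (hsub t ht hs)
  refine ⟨fun t ht h0t => ?_, fun t ht => ?_⟩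
  · rw [key t ht, abs_mul, Real.abs_exp]
    gcongr
    calc lam * t = ∫ _ in (0 : ℝ)..t, lam := by simp [mul_comm]
      _ ≤ _ := intervalIntegral.integral_mono_on h0t (by simp)
        (hcont.mono (hsub t ht)).intervalIntegrable fun s _ => hmono _
  · have hpos := Real.exp_pos (-∫ s in (0 : ℝ)..t, pderivU H (x s, p s, u s))
    rw [key t ht]
    exact ⟨mul_pos_iff_of_pos_left hpos, by simp, by simp [mul_neg_iff, hpos, hpos.not_gt]⟩
end

section
/- Let H : E × E × ℝ → ℝ be C¹ such that p ↦ H(x,p,u) is convex for every (x,u) and (∂H/∂u)(x,p,u) ≥ λ for some λ > 0 and all (x,p,u). Let x, p, p' ∈ E and u, w ∈ ℝ with u ≤ w and H(x, p', w) = 0. Then, setting v = (∂H/∂p)(x,p,u), one has ⟨p' − p, v⟩ + H(x,p,u) ≤ −λ (w − u). -/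
open scoped RealInnerProductSpace

/-- A convex function lies above its tangent hyperplane at any point of differentiability. -/
theorem ConvexOn.inner_gradient_add_le {F : Type*} [NormedAddCommGroup F] [InnerProductSpace ℝ F]
    [CompleteSpace F] {f : F → ℝ} (hf : ConvexOn ℝ Set.univ f) {p : F}
    (hd : DifferentiableAt ℝ f p) (q : F) : ⟪q - p, gradient f p⟫ + f p ≤ f q := by
  have hc : ConvexOn ℝ Set.univ (f ∘ AffineMap.lineMap (k := ℝ) p q) := by
    simpa using hf.comp_affineMap (AffineMap.lineMap (k := ℝ) p q)
  have hg : HasFDerivAt f (InnerProductSpace.toDual ℝ F (gradient f p))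
      (AffineMap.lineMap p q (0 : ℝ)) := by
    simpa using hd.hasGradientAt.hasFDerivAt
  have hderiv : HasDerivAt (f ∘ AffineMap.lineMap (k := ℝ) p q) ⟪gradient f p, q - p⟫ 0 :=
    hg.comp_hasDerivAt 0 AffineMap.hasDerivAt_lineMap
  have h := hc.le_slope_of_hasDerivAt (Set.mem_univ 0) (Set.mem_univ 1) one_pos hderiv
  simp only [slope_def_field, Function.comp_apply, AffineMap.lineMap_apply_zero,
    AffineMap.lineMap_apply_one, sub_zero, div_one] at h
  rw [real_inner_comm]
  linarith

theorem stmt_6 {n : ℕ} (hn : 1 ≤ n)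
    (H : EuclideanSpace ℝ (Fin n) × EuclideanSpace ℝ (Fin n) × ℝ → ℝ) (hH : ContDiff ℝ 1 H)
    (hconv : ∀ (x : EuclideanSpace ℝ (Fin n)) (u : ℝ), ConvexOn ℝ Set.univ (fun p => H (x, p, u)))
    (lam : ℝ) (hlam : 0 < lam) (hmono : ∀ z, lam ≤ pderivU H z)
    (x p p' : EuclideanSpace ℝ (Fin n)) (u w : ℝ) (huw : u ≤ w) (hzero : H (x, p', w) = 0) :
    ⟪p' - p, pgradP H (x, p, u)⟫ + H (x, p, u) ≤ -(lam * (w - u)) := by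
  have hd : Differentiable ℝ H := hH.differentiable one_ne_zero
  have hp := (hconv x u).inner_gradient_add_le (p := p)
    (hd.comp (by fun_prop : Differentiable ℝ
      fun p : EuclideanSpace ℝ (Fin n) => (x, p, u))).differentiableAt p'
  have hu := mul_sub_le_image_sub_of_le_deriv
    (hd.comp (by fun_prop : Differentiable ℝ fun u : ℝ => (x, p', u)))
    (fun s => hmono (x, p', s)) huw
  simp only [Function.comp_apply, hzero] at hu
  simp only [pgradP]
  linarith
end

section
/- Let H : E × E × ℝ → ℝ be C¹ such that p ↦ H(x,p,u) is convex for every (x,u) and (∂H/∂u)(x,p,u) ≥ λ for some λ > 0 and all (x,p,u). Let u₋ : E → ℝ be a C¹ function satisfying H(x, ∇u₋(x), u₋(x)) = 0 for every x ∈ E. Let z = (x,p,u) : [0,T] → E × E × ℝ be a solution of the contact Hamiltonian ODE associated to H, and set F(t) = u₋(x(t)) − u(t). If F(t) ≥ 0 for all t ∈ [0,T], then F(t) ≤ e^{−λt} F(0) for all t ∈ [0,T]. -/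
open scoped RealInnerProductSpace

/-- First-order characterisation of convexity: the tangent at `p` lies below the function. -/
lemma ConvexOn.add_inner_le_of_hasGradientAt {V : Type*} [NormedAddCommGroup V]
    [InnerProductSpace ℝ V] [CompleteSpace V] {f : V → ℝ} {g p : V}
    (hf : ConvexOn ℝ Set.univ f) (hg : HasGradientAt f g p) (q : V) :
    f p + ⟪g, q - p⟫ ≤ f q := by
  have hline : ConvexOn ℝ Set.univ (f ∘ AffineMap.lineMap (k := ℝ) p q) := by
    simpa using hf.comp_affineMap (AffineMap.lineMap (k := ℝ) p q)
  have hd : HasDerivAt (f ∘ AffineMap.lineMap (k := ℝ) p q) ⟪g, q - p⟫ 0 := by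
    have hg' : HasFDerivAt f (InnerProductSpace.toDual ℝ V g)
        (AffineMap.lineMap (k := ℝ) p q (0 : ℝ)) := by
      simpa using hg.hasFDerivAt
    simpa using hg'.comp_hasDerivAt (0 : ℝ) AffineMap.hasDerivAt_lineMap
  have h := hline.le_slope_of_hasDerivAt (Set.mem_univ 0) (Set.mem_univ 1) one_pos hd
  simp only [slope_def_field, Function.comp_apply, AffineMap.lineMap_apply_one,
    AffineMap.lineMap_apply_zero, sub_zero, div_one] at h
  linarith

/-- A differential form of Grönwall's inequality giving exponential decay. -/
lemma le_exp_neg_mul_of_hasDerivAt_le {F F' : ℝ → ℝ} {c T : ℝ}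
    (hd : ∀ t ∈ Set.Icc 0 T, HasDerivAt F (F' t) t)
    (hle : ∀ t ∈ Set.Icc 0 T, F' t ≤ -(c * F t)) :
    ∀ t ∈ Set.Icc 0 T, F t ≤ Real.exp (-(c * t)) * F 0 := by
  intro t ht
  have hG : ∀ s ∈ Set.Icc 0 T, HasDerivAt (fun s => Real.exp (c * s) * F s)
      (Real.exp (c * s) * (c * F s + F' s)) s := fun s hs => by
    refine (((hasDerivAt_id s).const_mul c).exp.mul (hd s hs)).congr_deriv ?_
    simp only [id]
    ring
  have hanti : AntitoneOn (fun s => Real.exp (c * s) * F s) (Set.Icc 0 T) := by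
    refine antitoneOn_of_deriv_nonpos (convex_Icc 0 T)
      (fun s hs => (hG s hs).continuousAt.continuousWithinAt)
      (fun s hs => (hG s (interior_subset hs)).differentiableAt.differentiableWithinAt)
      fun s hs => ?_
    rw [(hG s (interior_subset hs)).deriv]
    have := hle s (interior_subset hs)
    exact mul_nonpos_of_nonneg_of_nonpos (Real.exp_pos _).le (by linarith)
  have h := hanti ⟨le_rfl, ht.1.trans ht.2⟩ ht ht.1
  simp only [mul_zero, Real.exp_zero, one_mul] at h
  rw [Real.exp_neg, inv_mul_eq_div, le_div_iff₀ (Real.exp_pos _)]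
  linarith

theorem stmt_7 {n : ℕ} (hn : 1 ≤ n)
    (H : EuclideanSpace ℝ (Fin n) × EuclideanSpace ℝ (Fin n) × ℝ → ℝ) (hH : ContDiff ℝ 1 H)
    (hconv : ∀ (x : EuclideanSpace ℝ (Fin n)) (u : ℝ), ConvexOn ℝ Set.univ (fun p => H (x, p, u)))
    (lam : ℝ) (hlam : 0 < lam) (hmono : ∀ z, lam ≤ pderivU H z)
    (um : EuclideanSpace ℝ (Fin n) → ℝ) (hum : ContDiff ℝ 1 um)
    (hHJ : ∀ x : EuclideanSpace ℝ (Fin n), H (x, gradient um x, um x) = 0)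
    (T : ℝ) (x p : ℝ → EuclideanSpace ℝ (Fin n)) (u : ℝ → ℝ)
    (hsol : IsContactSol H (Set.Icc 0 T) x p u)
    (hF : ∀ t ∈ Set.Icc (0:ℝ) T, 0 ≤ um (x t) - u t) :
    ∀ t ∈ Set.Icc (0:ℝ) T,
      um (x t) - u t ≤ Real.exp (-(lam * t)) * (um (x 0) - u 0) := by
  have hHd : Differentiable ℝ H := hH.differentiable one_ne_zero
  have humd : Differentiable ℝ um := hum.differentiable one_ne_zero
  refine le_exp_neg_mul_of_hasDerivAt_le (F := fun t => um (x t) - u t)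
    (F' := fun t => ⟪gradient um (x t), pgradP H (x t, p t, u t)⟫ -
      (⟪pgradP H (x t, p t, u t), p t⟫ - H (x t, p t, u t)))
    (fun t ht => ?_) (fun t ht => ?_)
  · obtain ⟨hx, -, hu⟩ := hsol t ht
    have h := (humd (x t)).hasGradientAt.hasFDerivAt.comp_hasDerivAt t hx
    rw [InnerProductSpace.toDual_apply_apply] at h
    exact h.sub hu
  · have hp : HasGradientAt (fun q => H (x t, q, u t)) (pgradP H (x t, p t, u t)) (p t) := by
      have : DifferentiableAt ℝ (fun q => H (x t, q, u t)) (p t) := by fun_prop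
      exact this.hasGradientAt
    have htangent := (hconv (x t) (u t)).add_inner_le_of_hasGradientAt hp (gradient um (x t))
    have hdu : Differentiable ℝ (fun v => H (x t, gradient um (x t), v)) := by fun_prop
    have hgrowth := mul_sub_le_image_sub_of_le_deriv hdu
      (fun v => hmono (x t, gradient um (x t), v)) (sub_nonneg.mp (hF t ht))
    rw [hHJ] at hgrowth
    rw [inner_sub_right] at htangent
    rw [real_inner_comm (pgradP H (x t, p t, u t))]
    linarith
end

section
/- Let H : E × E × ℝ → ℝ be C¹ such that p ↦ H(x,p,u) is convex for every (x,u) and (∂H/∂u)(x,p,u) ≥ λ for some λ > 0 and all (x,p,u). Let u₋ : E → ℝ be a C¹ function satisfying H(x, ∇u₋(x), u₋(x)) = 0 for every x ∈ E, and let z = (x,p,u) : [0,T] → E × E × ℝ be a solution of the contact Hamiltonian ODE associated to H. Then: (i) if u(0) ≥ u₋(x(0)), then u(t) ≥ u₋(x(t)) for all t ∈ [0,T]; (ii) for any δ > 0, if u(0) > u₋(x(0)) − δ, then u(t) > u₋(x(t)) − δ for all t ∈ [0,T]. -/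
open scoped RealInnerProductSpace

theorem ConvexOn.add_inner_gradient_le {F : Type*} [NormedAddCommGroup F] [InnerProductSpace ℝ F]
    [CompleteSpace F] {f : F → ℝ} (hf : ConvexOn ℝ Set.univ f) {p : F}
    (hd : DifferentiableAt ℝ f p) (q : F) :
    f p + ⟪gradient f p, q - p⟫ ≤ f q := by
  have hline : HasDerivAt (AffineMap.lineMap p q : ℝ → F) (q - p) 0 :=
    AffineMap.hasDerivAt_lineMap
  have hg : HasFDerivAt f (InnerProductSpace.toDual ℝ F (gradient f p))
      ((AffineMap.lineMap p q : ℝ → F) 0) := by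
    simpa using hd.hasGradientAt.hasFDerivAt
  have hderiv : HasDerivAt (f ∘ AffineMap.lineMap p q) ⟪gradient f p, q - p⟫ (0 : ℝ) :=
    hg.comp_hasDerivAt (0 : ℝ) hline
  have hconv : ConvexOn ℝ Set.univ (f ∘ (AffineMap.lineMap p q : ℝ →ᵃ[ℝ] F)) := by
    simpa using hf.comp_affineMap (AffineMap.lineMap p q : ℝ →ᵃ[ℝ] F)
  have h := hconv.le_slope_of_hasDerivAt (Set.mem_univ 0) (Set.mem_univ 1) one_pos hderiv
  simp only [slope_def_field, Function.comp_apply, AffineMap.lineMap_apply_one,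
    AffineMap.lineMap_apply_zero, sub_zero, div_one] at h
  linarith

theorem le_of_deriv_pos_on_level {g g' : ℝ → ℝ} {c T : ℝ}
    (hg : ∀ t ∈ Set.Icc 0 T, HasDerivAt g (g' t) t)
    (hpos : ∀ t ∈ Set.Icc 0 T, g t = c → 0 < g' t) (h0 : c ≤ g 0) :
    ∀ t ∈ Set.Icc 0 T, c ≤ g t := by
  intro t ht
  have h := image_le_of_deriv_right_lt_deriv_boundary' (f := fun _ => c) (f' := fun _ => 0)
    (B := g) (B' := g') (a := 0) (b := T) continuousOn_const
    (fun s _ => hasDerivWithinAt_const _ _ _) h0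
    (fun s hs => (hg s hs).continuousAt.continuousWithinAt)
    (fun s hs => (hg s (Set.Ico_subset_Icc_self hs)).hasDerivWithinAt)
    (fun s hs hc => hpos s (Set.Ico_subset_Icc_self hs) hc.symm)
  exact h ht

theorem stmt_8 {n : ℕ} (hn : 1 ≤ n)
    (H : EuclideanSpace ℝ (Fin n) × EuclideanSpace ℝ (Fin n) × ℝ → ℝ) (hH : ContDiff ℝ 1 H)
    (hconv : ∀ (x : EuclideanSpace ℝ (Fin n)) (u : ℝ), ConvexOn ℝ Set.univ (fun p => H (x, p, u)))
    (lam : ℝ) (hlam : 0 < lam) (hmono : ∀ z, lam ≤ pderivU H z)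
    (um : EuclideanSpace ℝ (Fin n) → ℝ) (hum : ContDiff ℝ 1 um)
    (hHJ : ∀ x : EuclideanSpace ℝ (Fin n), H (x, gradient um x, um x) = 0)
    (T : ℝ) (x p : ℝ → EuclideanSpace ℝ (Fin n)) (u : ℝ → ℝ)
    (hsol : IsContactSol H (Set.Icc 0 T) x p u) :
    (um (x 0) ≤ u 0 → ∀ t ∈ Set.Icc (0:ℝ) T, um (x t) ≤ u t) ∧
    (∀ δ : ℝ, 0 < δ → um (x 0) - δ < u 0 →
      ∀ t ∈ Set.Icc (0:ℝ) T, um (x t) - δ < u t) := by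
  have hHd : Differentiable ℝ H := hH.differentiable one_ne_zero
  have hderiv : ∀ t ∈ Set.Icc (0:ℝ) T, HasDerivAt (fun s => u s - um (x s))
      (⟪pgradP H (x t, p t, u t), p t⟫ - H (x t, p t, u t)
        - ⟪gradient um (x t), pgradP H (x t, p t, u t)⟫) t := by
    intro t ht
    obtain ⟨hx, -, hu⟩ := hsol t ht
    have hg := (hum.differentiable one_ne_zero (x t)).hasGradientAt.hasFDerivAt
    simpa using! hu.sub (hg.comp_hasDerivAt t hx)
  have hstrict : ∀ y q, StrictMono fun v => H (y, q, v) := fun y q =>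
    strictMono_of_deriv_pos fun v => hlam.trans_le (hmono (y, q, v))
  have hlevel : ∀ c < 0, c ≤ u 0 - um (x 0) →
      ∀ t ∈ Set.Icc (0:ℝ) T, c ≤ u t - um (x t) := by
    intro c hc h0
    refine le_of_deriv_pos_on_level hderiv (fun t _ hgt => ?_) h0
    have hlt : H (x t, gradient um (x t), u t) < 0 := by
      rw [← hHJ (x t)]
      exact hstrict _ _ (by linarith)
    have htan := (hconv (x t) (u t)).add_inner_gradient_le (p := p t)
      (by fun_prop) (gradient um (x t))
    change H (x t, p t, u t) + ⟪pgradP H (x t, p t, u t), gradient um (x t) - p t⟫ ≤ _ at htan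
    rw [inner_sub_right, real_inner_comm] at htan
    linarith
  refine ⟨fun h0 t ht => ?_, fun δ hδ h0 t ht => ?_⟩
  · refine sub_nonneg.mp (le_of_forall_lt fun c hc => ?_)
    have := hlevel (c / 2) (by linarith) (by linarith) t ht
    linarith
  · have hc : -δ < min (u 0 - um (x 0)) (-δ / 2) := lt_min (by linarith) (by linarith)
    have := hlevel _ (min_lt_of_right_lt (by linarith : -δ / 2 < 0)) (min_le_left _ _) t ht
    linarith
end

section
/- Let K be a compact topological space and f : K × E → ℝ a continuous function such that for every x ∈ K the function p ↦ f(x,p) is convex, and for every x ∈ K one has f(x,p) → ∞ as ‖p‖ → ∞. Then f is uniformly coercive in p: for every e ∈ ℝ there exists P > 0 such that for all x ∈ K and all p ∈ E with ‖p‖ > P one has f(x,p) > e. -/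
/-- A convex function that is at most `c` at the origin and exceeds `c` on a sphere centred there
exceeds `c` everywhere outside that sphere. -/
theorem ConvexOn.lt_of_lt_on_sphere {E : Type*} [NormedAddCommGroup E] [NormedSpace ℝ E]
    {g : E → ℝ} (hg : ConvexOn ℝ Set.univ g) {c r : ℝ} (hr : 0 < r) (h0 : g 0 ≤ c)
    (hsphere : ∀ q ∈ Metric.sphere (0 : E) r, c < g q) {p : E} (hp : r < ‖p‖) : c < g p := by
  have hp0 : 0 < ‖p‖ := hr.trans hp
  set t := r / ‖p‖ with ht
  have ht0 : 0 < t := by positivity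
  have ht1 : t ≤ 1 := (div_le_one hp0).2 hp.le
  have hq : t • p ∈ Metric.sphere (0 : E) r := by
    rw [mem_sphere_zero_iff_norm, norm_smul, Real.norm_of_nonneg ht0.le, ht,
      div_mul_cancel₀ _ hp0.ne']
  have hle := hg.2 (Set.mem_univ 0) (Set.mem_univ p) (sub_nonneg.2 ht1) ht0.le
    (sub_add_cancel 1 t)
  simp only [smul_zero, zero_add, smul_eq_mul] at hle
  have hlt := hsphere _ hq
  by_contra! hgp
  nlinarith [mul_le_mul_of_nonneg_left h0 (sub_nonneg.2 ht1),
    mul_le_mul_of_nonneg_left hgp ht0.le]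

/-- A jointly continuous family of convex functions that is coercive at one parameter is
coercive uniformly in the nearby parameters. -/
theorem exists_eventually_forall_lt_of_convexOn {X E : Type*} [TopologicalSpace X]
    [NormedAddCommGroup E] [NormedSpace ℝ E] [ProperSpace E]
    {f : X × E → ℝ} (hf : Continuous f)
    (hconv : ∀ x, ConvexOn ℝ Set.univ (fun p => f (x, p))) {x₀ : X}
    (hcoer : ∀ c : ℝ, ∃ R > (0 : ℝ), ∀ p : E, R < ‖p‖ → c < f (x₀, p)) (e : ℝ) :
    ∃ P : ℝ, ∀ᶠ x in nhds x₀, ∀ p : E, P < ‖p‖ → e < f (x, p) := by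
  set c := max (f (x₀, 0) + 1) e
  obtain ⟨R, hR, hRc⟩ := hcoer c
  have hsphere : ∀ᶠ x in nhds x₀, ∀ q ∈ Metric.sphere (0 : E) (R + 1), c < f (x, q) := by
    refine (isCompact_sphere (0 : E) (R + 1)).eventually_forall_of_forall_eventually ?_
    intro q hq
    refine hf.continuousAt.eventually_const_lt (hRc q ?_)
    rw [mem_sphere_zero_iff_norm.1 hq]
    exact lt_add_one R
  have hzero : ∀ᶠ x in nhds x₀, f (x, 0) < c := by
    have hcont : Continuous fun x => f (x, 0) := by fun_prop
    exact hcont.continuousAt.eventually_lt_const ((lt_add_one _).trans_le (le_max_left _ _))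
  refine ⟨R + 1, ?_⟩
  filter_upwards [hsphere, hzero] with x hxs hx0 p hp
  exact (le_max_right _ _).trans_lt
    ((hconv x).lt_of_lt_on_sphere (by linarith) hx0.le hxs hp)

theorem stmt_9 {n : ℕ} (hn : 1 ≤ n)
    (K : Type*) [TopologicalSpace K] [CompactSpace K]
    (f : K × EuclideanSpace ℝ (Fin n) → ℝ) (hf : Continuous f)
    (hconv : ∀ x : K, ConvexOn ℝ Set.univ (fun p => f (x, p)))
    (hcoer : ∀ (x : K) (c : ℝ), ∃ R > (0:ℝ), ∀ p : EuclideanSpace ℝ (Fin n), R < ‖p‖ → c < f (x, p)) :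
    ∀ e : ℝ, ∃ P > (0:ℝ), ∀ (x : K) (p : EuclideanSpace ℝ (Fin n)), P < ‖p‖ → e < f (x, p) := by
  intro e
  choose P hP using fun x => exists_eventually_forall_lt_of_convexOn hf hconv (hcoer x) e
  obtain ⟨t, ht⟩ := CompactSpace.elim_nhds_subcover _ hP
  obtain ⟨M, hM⟩ := (t.image P).bddAbove
  refine ⟨max M 1, lt_max_of_lt_right one_pos, fun x p hp => ?_⟩
  have hx : x ∈ (⊤ : Set K) := Set.mem_univ x
  rw [← ht] at hx
  obtain ⟨y, hy, hxy⟩ := Set.mem_iUnion₂.1 hx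
  exact hxy p ((hM (Finset.mem_coe.2 (Finset.mem_image_of_mem P hy))).trans_lt
    ((le_max_left _ _).trans_lt hp))
end

section
/- Let K be a compact metric space and H : K × E × ℝ → ℝ a continuous function such that (i) for every (x,u) the function p ↦ H(x,p,u) is convex and satisfies H(x,p,u) → ∞ as ‖p‖ → ∞, and (ii) there is λ > 0 such that H(x,p,u') − H(x,p,u) ≥ λ(u' − u) whenever u ≤ u'. Then for every e, U ∈ ℝ the set { (x,p,u) ∈ K × E × ℝ : H(x,p,u) ≤ e and u ≥ U } is compact. -/
/-- A continuous family of convex functions, each of which exceeds every level outside some ball,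
has sublevel sets that are bounded locally uniformly in the parameter. -/
theorem eventually_norm_le_of_convexOn_of_coercive {X E : Type*} [TopologicalSpace X]
    [NormedAddCommGroup E] [NormedSpace ℝ E] [ProperSpace E] {f : X × E → ℝ} (hf : Continuous f)
    (hconv : ∀ x, ConvexOn ℝ Set.univ fun p => f (x, p)) {x₀ : X}
    (hcoer : ∀ c : ℝ, ∃ R > (0 : ℝ), ∀ p : E, R < ‖p‖ → c < f (x₀, p)) (e : ℝ) :
    ∃ R : ℝ, ∀ᶠ x in nhds x₀, ∀ p, f (x, p) ≤ e → ‖p‖ ≤ R := by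
  obtain ⟨R, hR, hlt⟩ := hcoer (max e (f (x₀, 0) + 1))
  refine ⟨R + 1, ?_⟩
  have hzero : ∀ᶠ x in nhds x₀, f (x, 0) < max e (f (x₀, 0) + 1) :=
    (show Continuous fun x => f (x, 0) by fun_prop).continuousAt.eventually_lt_const
      (lt_max_of_lt_right (lt_add_one _))
  have hsphere : ∀ᶠ x in nhds x₀, ∀ p ∈ Metric.sphere (0 : E) (R + 1),
      max e (f (x₀, 0) + 1) < f (x, p) := by
    refine (isCompact_sphere _ _).eventually_forall_of_forall_eventually fun p hp => ?_
    refine hf.continuousAt.eventually_const_lt (hlt p ?_)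
    rw [mem_sphere_zero_iff_norm.mp hp]
    exact lt_add_one R
  filter_upwards [hzero, hsphere] with x h0 hs p hp
  by_contra! hnorm
  have hpos : 0 < ‖p‖ := by linarith
  have hq : ((R + 1) / ‖p‖) • p ∈ Metric.sphere (0 : E) (R + 1) := by
    rw [mem_sphere_zero_iff_norm, norm_smul, Real.norm_of_nonneg (by positivity),
      div_mul_cancel₀ _ hpos.ne']
  have hseg : ((R + 1) / ‖p‖) • p ∈ segment ℝ 0 p :=
    ⟨1 - (R + 1) / ‖p‖, (R + 1) / ‖p‖, sub_nonneg.mpr ((div_le_one hpos).mpr hnorm.le),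
      by positivity, by ring, by simp⟩
  have hmax := (hconv x).le_max_of_mem_segment (Set.mem_univ _) (Set.mem_univ _) hseg
  exact absurd (hs _ hq) (not_lt.mpr (hmax.trans (max_le h0.le (hp.trans (le_max_left _ _)))))

/-- Over a compact parameter space, sublevel sets of a continuous family of convex coercive
functions are uniformly bounded. -/
theorem exists_norm_le_of_convexOn_of_coercive {X E : Type*} [TopologicalSpace X] [CompactSpace X]
    [NormedAddCommGroup E] [NormedSpace ℝ E] [ProperSpace E] {f : X × E → ℝ} (hf : Continuous f)
    (hconv : ∀ x, ConvexOn ℝ Set.univ fun p => f (x, p))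
    (hcoer : ∀ (x : X) (c : ℝ), ∃ R > (0 : ℝ), ∀ p : E, R < ‖p‖ → c < f (x, p)) (e : ℝ) :
    ∃ R : ℝ, ∀ x p, f (x, p) ≤ e → ‖p‖ ≤ R := by
  suffices h : ∃ R : ℝ, ∀ x ∈ (Set.univ : Set X), ∀ p, f (x, p) ≤ e → ‖p‖ ≤ R by simpa using h
  refine isCompact_univ.induction_on
    (p := fun s => ∃ R : ℝ, ∀ x ∈ s, ∀ p, f (x, p) ≤ e → ‖p‖ ≤ R) ⟨0, by simp⟩ ?_ ?_ ?_
  · rintro s t hst ⟨R, hR⟩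
    exact ⟨R, fun x hx => hR x (hst hx)⟩
  · rintro s t ⟨R, hR⟩ ⟨R', hR'⟩
    refine ⟨max R R', ?_⟩
    rintro x (hx | hx) p hp
    · exact (hR x hx p hp).trans (le_max_left _ _)
    · exact (hR' x hx p hp).trans (le_max_right _ _)
  · intro x _
    obtain ⟨R, hR⟩ := eventually_norm_le_of_convexOn_of_coercive hf hconv (hcoer x) e
    exact ⟨_, mem_nhdsWithin_of_mem_nhds hR, R, fun _ hy => hy⟩

theorem stmt_10 {n : ℕ} (hn : 1 ≤ n)
    (K : Type*) [MetricSpace K] [CompactSpace K]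
    (H : K × EuclideanSpace ℝ (Fin n) × ℝ → ℝ) (hH : Continuous H)
    (hconv : ∀ (x : K) (u : ℝ), ConvexOn ℝ Set.univ (fun p => H (x, p, u)))
    (hcoer : ∀ (x : K) (u : ℝ) (c : ℝ), ∃ R > (0:ℝ), ∀ p : EuclideanSpace ℝ (Fin n), R < ‖p‖ → c < H (x, p, u))
    (lam : ℝ) (hlam : 0 < lam)
    (hmono : ∀ (x : K) (p : EuclideanSpace ℝ (Fin n)) (u u' : ℝ), u ≤ u' →
      lam * (u' - u) ≤ H (x, p, u') - H (x, p, u))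
    (e U : ℝ) :
    IsCompact {z : K × EuclideanSpace ℝ (Fin n) × ℝ | H z ≤ e ∧ U ≤ z.2.2} := by
  obtain ⟨R, hR⟩ := exists_norm_le_of_convexOn_of_coercive
    (f := fun y : K × EuclideanSpace ℝ (Fin n) => H (y.1, y.2, U)) (by fun_prop)
    (fun x => hconv x U) (fun x => hcoer x U) e
  have hball : IsCompact ((Set.univ : Set K) ×ˢ
      Metric.closedBall (0 : EuclideanSpace ℝ (Fin n)) R) :=
    isCompact_univ.prod (isCompact_closedBall _ _)
  obtain ⟨m, hm⟩ := hball.bddBelow_image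
    (f := fun y : K × EuclideanSpace ℝ (Fin n) => H (y.1, y.2, U)) (by fun_prop)
  refine (isCompact_univ.prod ((isCompact_closedBall (0 : EuclideanSpace ℝ (Fin n)) R).prod
    (isCompact_Icc (a := U) (b := U + (e - m) / lam)))).of_isClosed_subset ?_ ?_
  · exact (isClosed_le hH continuous_const).inter
      (isClosed_le continuous_const (continuous_snd.comp continuous_snd))
  · rintro ⟨x, p, u⟩ ⟨hle, hu⟩
    dsimp only at hle hu
    have hgap := hmono x p U u hu
    have hp : ‖p‖ ≤ R := hR x p (by
      have : 0 ≤ lam * (u - U) := mul_nonneg hlam.le (sub_nonneg.mpr hu)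
      dsimp only
      linarith)
    have hlow : m ≤ H (x, p, U) :=
      hm ⟨(x, p), ⟨Set.mem_univ _, mem_closedBall_zero_iff.mpr hp⟩, rfl⟩
    have hub : u - U ≤ (e - m) / lam := by
      rw [le_div_iff₀ hlam]
      linarith
    exact ⟨Set.mem_univ _, mem_closedBall_zero_iff.mpr hp, hu, by dsimp only; linarith⟩
end

section
/- Let H : E × E × ℝ → ℝ be C² such that for every (x,u) the Hessian of p ↦ H(x,p,u) is positive definite at every p, and (∂H/∂p)(x,0,u) = 0 for every (x,u). Let z = (x,p,u) : I → E × E × ℝ be a solution of the contact Hamiltonian ODE associated to H with H(z(t)) = 0 for all t ∈ I. Then t ↦ u(t) is monotone nondecreasing on I, with u'(t) = ⟨(∂H/∂p)(z(t)), p(t)⟩ ≥ 0; moreover, for t₀ ∈ I, u'(t₀) = 0 implies p(t₀) = 0 and x'(t₀) = 0. -/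
open scoped RealInnerProductSpace

theorem inner_gradient_pos_of_hessian_pos {F : Type*} [NormedAddCommGroup F]
    [InnerProductSpace ℝ F] [CompleteSpace F] {f : F → ℝ} (hf : ContDiff ℝ 2 f)
    (hess : ∀ p w : F, w ≠ 0 → 0 < iteratedFDeriv ℝ 2 f p ![w, w])
    (h0 : gradient f 0 = 0) {p : F} (hp : p ≠ 0) : 0 < ⟪gradient f p, p⟫ := by
  have hinner (q : F) : ⟪gradient f q, p⟫ = fderiv ℝ f q p := by
    simp [gradient]
  have hderiv (s : ℝ) : HasDerivAt (fun s : ℝ => fderiv ℝ f (s • p) p)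
      (fderiv ℝ (fderiv ℝ f) (s • p) p p) s := by
    have h1 : HasFDerivAt (fderiv ℝ f) (fderiv ℝ (fderiv ℝ f) (s • p)) (s • p) :=
      ((hf.fderiv_right (m := 1) (by norm_num)).differentiable (by norm_num) _).hasFDerivAt
    have h2 : HasDerivAt (fun s : ℝ => s • p) p s := by
      simpa using (hasDerivAt_id s).smul_const p
    have h3 : HasDerivAt (fun s : ℝ => fderiv ℝ f (s • p)) (fderiv ℝ (fderiv ℝ f) (s • p) p) s :=
      h1.comp_hasDerivAt s h2
    exact ((ContinuousLinearMap.apply ℝ ℝ p).hasFDerivAt.comp_hasDerivAt s h3)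
  have hmono : StrictMono fun s : ℝ => fderiv ℝ f (s • p) p := by
    refine strictMono_of_deriv_pos fun s => ?_
    rw [(hderiv s).deriv]
    simpa [iteratedFDeriv_two_apply] using hess (s • p) p hp
  have h := hmono zero_lt_one
  simp only [zero_smul, one_smul, ← hinner, h0, inner_zero_left] at h
  exact h

theorem stmt_13 {n : ℕ} (hn : 1 ≤ n)
    (H : EuclideanSpace ℝ (Fin n) × EuclideanSpace ℝ (Fin n) × ℝ → ℝ) (hH : ContDiff ℝ 2 H)
    (hhess : ∀ (x : EuclideanSpace ℝ (Fin n)) (u : ℝ) (p w : EuclideanSpace ℝ (Fin n)), w ≠ 0 →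
      0 < iteratedFDeriv ℝ 2 (fun q => H (x, q, u)) p ![w, w])
    (hp0 : ∀ (x : EuclideanSpace ℝ (Fin n)) (u : ℝ), pgradP H (x, (0 : EuclideanSpace ℝ (Fin n)), u) = 0)
    (I : Set ℝ) (hI : I.OrdConnected)
    (x p : ℝ → EuclideanSpace ℝ (Fin n)) (u : ℝ → ℝ)
    (hsol : IsContactSol H I x p u)
    (hH0 : ∀ t ∈ I, H (x t, p t, u t) = 0) :
    MonotoneOn u I ∧
    (∀ t ∈ I, HasDerivAt u (⟪pgradP H (x t, p t, u t), p t⟫) t ∧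
      0 ≤ ⟪pgradP H (x t, p t, u t), p t⟫) ∧
    (∀ t ∈ I, ⟪pgradP H (x t, p t, u t), p t⟫ = 0 →
      p t = 0 ∧ pgradP H (x t, p t, u t) = 0) := by
  have hpos (t : ℝ) (ht : p t ≠ 0) : 0 < ⟪pgradP H (x t, p t, u t), p t⟫ :=
    inner_gradient_pos_of_hessian_pos (f := fun q => H (x t, q, u t))
      (hH.comp (by fun_prop)) (hhess (x t) (u t)) (hp0 (x t) (u t)) ht
  have hnonneg (t : ℝ) : 0 ≤ ⟪pgradP H (x t, p t, u t), p t⟫ := by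
    by_cases ht : p t = 0
    · simp [ht]
    · exact (hpos t ht).le
  have hu (t : ℝ) (ht : t ∈ I) : HasDerivAt u ⟪pgradP H (x t, p t, u t), p t⟫ t := by
    simpa [hH0 t ht] using (hsol t ht).2.2
  refine ⟨?_, fun t ht => ⟨hu t ht, hnonneg t⟩, fun t _ h => ?_⟩
  · refine monotoneOn_of_deriv_nonneg hI.convex
      (fun t ht => (hu t ht).continuousAt.continuousWithinAt)
      (fun t ht => (hu t (interior_subset ht)).differentiableAt.differentiableWithinAt)
      fun t ht => ?_
    rw [(hu t (interior_subset ht)).deriv]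
    exact hnonneg t
  · have hpt : p t = 0 := by
      by_contra hne
      exact (hpos t hne).ne' h
    exact ⟨hpt, by rw [hpt]; exact hp0 (x t) (u t)⟩
end

section
/- Let H : E × E × ℝ → ℝ be C² such that for every (x,u) the Hessian of p ↦ H(x,p,u) is positive definite at every p, and (∂H/∂p)(x,0,u) = 0 for every (x,u). Let z = (x,p,u) : I → E × E × ℝ be a solution of the contact Hamiltonian ODE associated to H with H(z(t)) = 0 for all t ∈ I. If t₀ < t₁ lie in I and there exists t* ∈ [t₀,t₁] with p(t*) ≠ 0, then u(t₁) > u(t₀). -/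
open scoped RealInnerProductSpace

theorem inner_gradient_self_pos {F : Type*} [NormedAddCommGroup F] [InnerProductSpace ℝ F]
    [CompleteSpace F] {f : F → ℝ} (hf : ContDiff ℝ 2 f)
    (hhess : ∀ p w : F, w ≠ 0 → 0 < iteratedFDeriv ℝ 2 f p ![w, w])
    (h0 : gradient f 0 = 0) {p : F} (hp : p ≠ 0) : 0 < ⟪gradient f p, p⟫ := by
  have hd : Differentiable ℝ (fderiv ℝ f) :=
    (hf.fderiv_right (m := 1) (by norm_num)).differentiable (by norm_num)
  have hg : ∀ s : ℝ, HasDerivAt (fun s : ℝ => fderiv ℝ f (s • p) p)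
      (fderiv ℝ (fderiv ℝ f) (s • p) p p) s := by
    intro s
    have h1 : HasDerivAt (fun s : ℝ => s • p) p s := by
      simpa using (hasDerivAt_id s).smul_const p
    have h2 := (hd (s • p)).hasFDerivAt.comp_hasDerivAt s h1
    simpa using HasDerivAt.clm_apply h2 (hasDerivAt_const s p)
  have hmono : StrictMono (fun s : ℝ => fderiv ℝ f (s • p) p) := by
    apply strictMono_of_deriv_pos
    intro s
    rw [(hg s).deriv]
    simpa [iteratedFDeriv_two_apply] using hhess (s • p) p hp
  have hz : fderiv ℝ f 0 p = 0 := by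
    rw [gradient, map_eq_zero_iff _ (InnerProductSpace.toDual ℝ F).symm.injective] at h0
    simp [h0]
  have h := hmono zero_lt_one
  simpa [hz, gradient] using h

theorem stmt_14 {n : ℕ} (hn : 1 ≤ n)
    (H : EuclideanSpace ℝ (Fin n) × EuclideanSpace ℝ (Fin n) × ℝ → ℝ) (hH : ContDiff ℝ 2 H)
    (hhess : ∀ (x : EuclideanSpace ℝ (Fin n)) (u : ℝ) (p w : EuclideanSpace ℝ (Fin n)), w ≠ 0 →
      0 < iteratedFDeriv ℝ 2 (fun q => H (x, q, u)) p ![w, w])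
    (hp0 : ∀ (x : EuclideanSpace ℝ (Fin n)) (u : ℝ), pgradP H (x, (0 : EuclideanSpace ℝ (Fin n)), u) = 0)
    (I : Set ℝ)
    (x p : ℝ → EuclideanSpace ℝ (Fin n)) (u : ℝ → ℝ)
    (hsol : IsContactSol H I x p u)
    (hH0 : ∀ t ∈ I, H (x t, p t, u t) = 0)
    (t₀ t₁ : ℝ) (ht : t₀ < t₁) (hsub : Set.Icc t₀ t₁ ⊆ I)
    (hex : ∃ ts ∈ Set.Icc t₀ t₁, p ts ≠ 0) :
    u t₀ < u t₁ := by
  have hpos : ∀ t, p t ≠ 0 → 0 < ⟪pgradP H (x t, p t, u t), p t⟫ := fun t hpt =>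
    inner_gradient_self_pos (f := fun q => H (x t, q, u t)) (by fun_prop)
      (hhess (x t) (u t)) (hp0 (x t) (u t)) hpt
  have hnonneg : ∀ t, 0 ≤ ⟪pgradP H (x t, p t, u t), p t⟫ := fun t => by
    by_cases hpt : p t = 0
    · simp [hpt]
    · exact (hpos t hpt).le
  have hu : ∀ t ∈ Set.Icc t₀ t₁, HasDerivAt u ⟪pgradP H (x t, p t, u t), p t⟫ t := fun t htI => by
    simpa [hH0 t (hsub htI)] using (hsol t (hsub htI)).2.2
  have hmono : MonotoneOn u (Set.Icc t₀ t₁) :=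
    monotoneOn_of_hasDerivWithinAt_nonneg (convex_Icc t₀ t₁)
      (fun t htI => (hu t htI).continuousAt.continuousWithinAt)
      (fun t htI => (hu t (interior_subset htI)).hasDerivWithinAt) (fun t _ => hnonneg t)
  by_contra! hle
  obtain ⟨s, hs, hps⟩ := hex
  have hconst : ∀ t ∈ Set.Icc t₀ t₁, u t = u t₀ := fun t htI =>
    le_antisymm ((hmono htI (Set.right_mem_Icc.2 ht.le) htI.2).trans hle)
      (hmono (Set.left_mem_Icc.2 ht.le) htI htI.1)
  have hzero : HasDerivWithinAt u 0 (Set.Icc t₀ t₁) s :=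
    (hasDerivWithinAt_const s (Set.Icc t₀ t₁) (u t₀)).congr hconst (hconst s hs)
  exact (hpos s hps).ne' ((uniqueDiffOn_Icc ht s hs).eq_deriv _ (hu s hs).hasDerivWithinAt hzero)
end

section
/- Let h : E × E → ℝ be C², λ > 0, and let (x,p) : ℝ → E × E solve the discounted system x'(t) = (∂h/∂p)(x(t),p(t)), p'(t) = −(∂h/∂x)(x(t),p(t)) − λ p(t). Define u : ℝ → ℝ by u(t) = e^{−λt} [ −h(x(0),p(0))/λ + ∫₀ᵗ e^{λs} ( ⟨(∂h/∂p)(x(s),p(s)), p(s)⟩ − h(x(s),p(s)) ) ds ]. Then λ u(t) + h(x(t),p(t)) = 0 for all t ∈ ℝ, and the curve z(t) = (x(t),p(t),u(t)) solves the contact Hamiltonian ODE associated to H(x,p,u) = λu + h(x,p). -/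
open scoped RealInnerProductSpace

noncomputable def hgradX {n : ℕ} (h : EuclideanSpace ℝ (Fin n) × EuclideanSpace ℝ (Fin n) → ℝ) (q : EuclideanSpace ℝ (Fin n) × EuclideanSpace ℝ (Fin n)) : EuclideanSpace ℝ (Fin n) :=
  gradient (fun x => h (x, q.2)) q.1

noncomputable def hgradP {n : ℕ} (h : EuclideanSpace ℝ (Fin n) × EuclideanSpace ℝ (Fin n) → ℝ) (q : EuclideanSpace ℝ (Fin n) × EuclideanSpace ℝ (Fin n)) : EuclideanSpace ℝ (Fin n) :=
  gradient (fun p => h (q.1, p)) q.2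

section PartialGradients

variable {n : ℕ} {h : EuclideanSpace ℝ (Fin n) × EuclideanSpace ℝ (Fin n) → ℝ}

theorem hgradX_eq_of_differentiableAt {q : EuclideanSpace ℝ (Fin n) × EuclideanSpace ℝ (Fin n)}
    (hq : DifferentiableAt ℝ h q) :
    hgradX h q = (InnerProductSpace.toDual ℝ (EuclideanSpace ℝ (Fin n))).symm
      ((fderiv ℝ h q).comp (ContinuousLinearMap.inl ℝ _ _)) := by
  unfold hgradX gradient
  congr 1
  exact (HasFDerivAt.comp q.1 (f := fun x => (x, q.2)) hq.hasFDerivAt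
    (hasFDerivAt_prodMk_left q.1 q.2)).fderiv

theorem hgradP_eq_of_differentiableAt {q : EuclideanSpace ℝ (Fin n) × EuclideanSpace ℝ (Fin n)}
    (hq : DifferentiableAt ℝ h q) :
    hgradP h q = (InnerProductSpace.toDual ℝ (EuclideanSpace ℝ (Fin n))).symm
      ((fderiv ℝ h q).comp (ContinuousLinearMap.inr ℝ _ _)) := by
  unfold hgradP gradient
  congr 1
  exact (HasFDerivAt.comp q.2 (f := fun p => (q.1, p)) hq.hasFDerivAt
    (hasFDerivAt_prodMk_right q.1 q.2)).fderiv

theorem continuous_hgradP (hh : ContDiff ℝ 1 h) : Continuous (hgradP h) := by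
  have hd : Differentiable ℝ h := hh.differentiable one_ne_zero
  rw [show hgradP h = _ from funext fun q => hgradP_eq_of_differentiableAt (hd q)]
  exact (LinearIsometryEquiv.continuous _).comp
    ((hh.continuous_fderiv one_ne_zero).clm_comp continuous_const)

theorem fderiv_eq_inner_hgradX_add_inner_hgradP
    {q : EuclideanSpace ℝ (Fin n) × EuclideanSpace ℝ (Fin n)}
    (hq : DifferentiableAt ℝ h q) (v w : EuclideanSpace ℝ (Fin n)) :
    fderiv ℝ h q (v, w) = ⟪hgradX h q, v⟫ + ⟪hgradP h q, w⟫ := by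
  rw [hgradX_eq_of_differentiableAt hq, hgradP_eq_of_differentiableAt hq,
    InnerProductSpace.toDual_symm_apply, InnerProductSpace.toDual_symm_apply]
  simp [← map_add]

/-- Along the discounted flow the Hamiltonian dissipates at rate `lam * ⟪∂h/∂p, p⟫`. -/
theorem hasDerivAt_hamiltonian_of_discounted {lam t : ℝ} {x p : ℝ → EuclideanSpace ℝ (Fin n)}
    (hq : DifferentiableAt ℝ h (x t, p t))
    (hx : HasDerivAt x (hgradP h (x t, p t)) t)
    (hp : HasDerivAt p (-hgradX h (x t, p t) - lam • p t) t) :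
    HasDerivAt (fun s => h (x s, p s)) (-lam * ⟪hgradP h (x t, p t), p t⟫) t := by
  have key := HasFDerivAt.comp_hasDerivAt (f := fun s => (x s, p s)) t hq.hasFDerivAt
    (hx.prodMk hp)
  rw [fderiv_eq_inner_hgradX_add_inner_hgradP hq, inner_sub_right, inner_neg_right,
    inner_smul_right, real_inner_comm] at key
  exact key.congr_deriv (by ring)

end PartialGradients

theorem stmt_16 {n : ℕ} (hn : 1 ≤ n)
    (h : EuclideanSpace ℝ (Fin n) × EuclideanSpace ℝ (Fin n) → ℝ) (hh : ContDiff ℝ 2 h)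
    (lam : ℝ) (hlam : 0 < lam)
    (x p : ℝ → EuclideanSpace ℝ (Fin n))
    (hsol : ∀ t : ℝ, HasDerivAt x (hgradP h (x t, p t)) t ∧
      HasDerivAt p (-hgradX h (x t, p t) - lam • p t) t)
    (u : ℝ → ℝ)
    (hu : ∀ t : ℝ, u t = Real.exp (-(lam * t)) *
      (-(h (x 0, p 0)) / lam +
        ∫ s in (0:ℝ)..t,
          Real.exp (lam * s) * (⟪hgradP h (x s, p s), p s⟫ - h (x s, p s)))) :
    (∀ t : ℝ, lam * u t + h (x t, p t) = 0) ∧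
    IsContactSol (fun z => lam * z.2.2 + h (z.1, z.2.1)) Set.univ x p u := by
  have hd : Differentiable ℝ h := hh.differentiable two_ne_zero
  have hderiv (t : ℝ) := hasDerivAt_hamiltonian_of_discounted (hd _) (hsol t).1 (hsol t).2
  have hxc : Continuous x := continuous_iff_continuousAt.2 fun t => (hsol t).1.continuousAt
  have hpc : Continuous p := continuous_iff_continuousAt.2 fun t => (hsol t).2.continuousAt
  have hgc : Continuous fun t => hgradP h (x t, p t) :=
    (continuous_hgradP (hh.of_le one_le_two)).comp (hxc.prodMk hpc)
  have hhc : Continuous fun t => h (x t, p t) := hh.continuous.comp (hxc.prodMk hpc)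
  have hint (t : ℝ) : ∫ s in (0:ℝ)..t,
      Real.exp (lam * s) * (⟪hgradP h (x s, p s), p s⟫ - h (x s, p s)) =
      -(Real.exp (lam * t) * h (x t, p t)) / lam - -h (x 0, p 0) / lam := by
    have hprim (s : ℝ) : HasDerivAt (fun s => -(Real.exp (lam * s) * h (x s, p s)) / lam)
        (Real.exp (lam * s) * (⟪hgradP h (x s, p s), p s⟫ - h (x s, p s))) s := by
      have he : HasDerivAt (fun s => Real.exp (lam * s)) (Real.exp (lam * s) * lam) s := by
        simpa using ((hasDerivAt_id s).const_mul lam).exp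
      refine ((he.mul (hderiv s)).neg.div_const lam).congr_deriv ?_
      field_simp
      ring
    rw [intervalIntegral.integral_eq_sub_of_hasDerivAt (fun s _ => hprim s)]
    · simp
    · exact Continuous.intervalIntegrable (by fun_prop) _ _
  have hu' (t : ℝ) : u t = -h (x t, p t) / lam := by
    rw [hu, hint, add_sub_cancel, Real.exp_neg]
    field_simp
  have hzero (t : ℝ) : lam * u t + h (x t, p t) = 0 := by
    rw [hu']
    field_simp
    ring
  refine ⟨hzero, fun t _ => ?_⟩
  have hP : pgradP (fun z => lam * z.2.2 + h (z.1, z.2.1)) (x t, p t, u t) =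
      hgradP h (x t, p t) := by
    simp [pgradP, hgradP, gradient]
  have hX : pgradX (fun z => lam * z.2.2 + h (z.1, z.2.1)) (x t, p t, u t) =
      hgradX h (x t, p t) := by
    simp [pgradX, hgradX, gradient]
  have hU : pderivU (fun z => lam * z.2.2 + h (z.1, z.2.1)) (x t, p t, u t) = lam := by
    simp [pderivU]
  rw [hP, hX, hU]
  refine ⟨(hsol t).1, (hsol t).2, ?_⟩
  beta_reduce
  rw [hzero, sub_zero, show u = _ from funext hu']
  refine ((hderiv t).neg.div_const lam).congr_deriv ?_
  field_simp
end

section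
/- Let h : E × E → ℝ be C² such that for every x the Hessian of p ↦ h(x,p) is positive definite at every p and (∂h/∂p)(x,0) = 0 for every x, and let λ > 0. Let (x,p) : I → E × E solve the discounted system x'(t) = (∂h/∂p)(x(t),p(t)), p'(t) = −(∂h/∂x)(x(t),p(t)) − λ p(t) on an interval I. Then (d/dt) h(x(t),p(t)) = −λ ⟨(∂h/∂p)(x(t),p(t)), p(t)⟩ ≤ 0 for all t ∈ I; in particular t ↦ h(x(t),p(t)) is monotone nonincreasing on I. -/
open scoped RealInnerProductSpace

/-- A `C²` function with positive semidefinite Hessian whose derivative vanishes at the origin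
has nonnegative radial derivative. -/
lemma fderiv_apply_self_nonneg {F : Type*} [NormedAddCommGroup F] [NormedSpace ℝ F] {f : F → ℝ}
    (hf : ContDiff ℝ 2 f) (hess : ∀ y w, 0 ≤ iteratedFDeriv ℝ 2 f y ![w, w])
    (h0 : fderiv ℝ f 0 = 0) (y : F) : 0 ≤ fderiv ℝ f y y := by
  have hd : Differentiable ℝ (fderiv ℝ f) :=
    (hf.fderiv_right (m := 1) (by norm_num)).differentiable (by norm_num)
  have key : ∀ s : ℝ, HasDerivAt (fun s : ℝ => fderiv ℝ f (s • y) y)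
      (fderiv ℝ (fderiv ℝ f) (s • y) y y) s := by
    intro s
    have hs : HasDerivAt (fun s : ℝ => s • y) y s := by
      simpa using (hasDerivAt_id s).smul_const y
    have hcomp := (hd (s • y)).hasFDerivAt.comp_hasDerivAt s hs
    simpa using hcomp.clm_apply (hasDerivAt_const s y)
  have hmono := monotone_of_hasDerivAt_nonneg key fun s => by
    simpa [iteratedFDeriv_two_apply] using hess (s • y) y
  simpa [h0] using hmono (zero_le_one (α := ℝ))

section PartialGradients

variable {n : ℕ} {h : EuclideanSpace ℝ (Fin n) × EuclideanSpace ℝ (Fin n) → ℝ}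
  {q : EuclideanSpace ℝ (Fin n) × EuclideanSpace ℝ (Fin n)}

lemma inner_hgradX (hd : DifferentiableAt ℝ h q) (v : EuclideanSpace ℝ (Fin n)) :
    ⟪hgradX h q, v⟫ = fderiv ℝ h q (v, 0) := by
  have hq : HasFDerivAt (fun x => h (x, q.2)) _ q.1 :=
    hd.hasFDerivAt.comp q.1 (hasFDerivAt_prodMk_left q.1 q.2)
  rw [hgradX, inner_gradient_left, hq.fderiv]
  simp

lemma inner_hgradP (hd : DifferentiableAt ℝ h q) (w : EuclideanSpace ℝ (Fin n)) :
    ⟪hgradP h q, w⟫ = fderiv ℝ h q (0, w) := by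
  have hq : HasFDerivAt (fun p => h (q.1, p)) _ q.2 :=
    hd.hasFDerivAt.comp q.2 (hasFDerivAt_prodMk_right q.1 q.2)
  rw [hgradP, inner_gradient_left, hq.fderiv]
  simp

lemma fderiv_apply_eq_inner_hgradX_add_inner_hgradP (hd : DifferentiableAt ℝ h q)
    (v w : EuclideanSpace ℝ (Fin n)) :
    fderiv ℝ h q (v, w) = ⟪hgradX h q, v⟫ + ⟪hgradP h q, w⟫ := by
  rw [inner_hgradX hd, inner_hgradP hd, ← map_add]
  simp

end PartialGradients

theorem stmt_17 {n : ℕ} (hn : 1 ≤ n)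
    (h : EuclideanSpace ℝ (Fin n) × EuclideanSpace ℝ (Fin n) → ℝ) (hh : ContDiff ℝ 2 h)
    (hhess : ∀ (x p w : EuclideanSpace ℝ (Fin n)), w ≠ 0 →
      0 < iteratedFDeriv ℝ 2 (fun q => h (x, q)) p ![w, w])
    (hp0 : ∀ x : EuclideanSpace ℝ (Fin n), hgradP h (x, (0 : EuclideanSpace ℝ (Fin n))) = 0)
    (lam : ℝ) (hlam : 0 < lam)
    (I : Set ℝ) (hI : I.OrdConnected)
    (x p : ℝ → EuclideanSpace ℝ (Fin n))
    (hsol : ∀ t ∈ I, HasDerivAt x (hgradP h (x t, p t)) t ∧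
      HasDerivAt p (-hgradX h (x t, p t) - lam • p t) t) :
    (∀ t ∈ I, HasDerivAt (fun s => h (x s, p s))
        (-(lam * ⟪hgradP h (x t, p t), p t⟫)) t ∧
      -(lam * ⟪hgradP h (x t, p t), p t⟫) ≤ 0) ∧
    AntitoneOn (fun t => h (x t, p t)) I := by
  have hpos : ∀ a b : EuclideanSpace ℝ (Fin n), 0 ≤ ⟪hgradP h (a, b), b⟫ := by
    intro a b
    rw [hgradP, inner_gradient_left]
    refine fderiv_apply_self_nonneg (hh.comp (contDiff_prodMk_right a)) (fun y w => ?_) ?_ b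
    · rcases eq_or_ne w 0 with rfl | hw
      · simp [iteratedFDeriv_two_apply]
      · exact (hhess a y w hw).le
    · rw [← toDual_gradient]
      exact (congrArg _ (hp0 a)).trans (map_zero _)
  have hderiv : ∀ t ∈ I, HasDerivAt (fun s => h (x s, p s))
      (-(lam * ⟪hgradP h (x t, p t), p t⟫)) t := by
    intro t ht
    obtain ⟨hx, hp⟩ := hsol t ht
    have hd : DifferentiableAt ℝ h (x t, p t) := hh.differentiable (by norm_num) _
    have hc := hd.hasFDerivAt.comp_hasDerivAt t (hx.prodMk hp)
    rw [fderiv_apply_eq_inner_hgradX_add_inner_hgradP hd] at hc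
    refine hc.congr_deriv ?_
    rw [inner_sub_right, inner_neg_right, inner_smul_right,
      real_inner_comm (hgradX h (x t, p t))]
    ring
  have hnonpos : ∀ t, -(lam * ⟪hgradP h (x t, p t), p t⟫) ≤ 0 := fun t =>
    neg_nonpos.mpr (mul_nonneg hlam.le (hpos _ _))
  refine ⟨fun t ht => ⟨hderiv t ht, hnonpos t⟩, ?_⟩
  exact antitoneOn_of_hasDerivWithinAt_nonpos hI.convex
    (fun t ht => (hderiv t ht).continuousAt.continuousWithinAt)
    (fun t ht => (hderiv t (interior_subset ht)).hasDerivWithinAt) fun t _ => hnonpos t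
end

section
/- Let h : E × E → ℝ be C² such that for every x the Hessian of p ↦ h(x,p) is positive definite at every p and (∂h/∂p)(x,0) = 0 for every x, and let λ > 0. Let (x,p) : ℝ → E × E be a solution of the discounted system x'(t) = (∂h/∂p)(x(t),p(t)), p'(t) = −(∂h/∂x)(x(t),p(t)) − λ p(t) defined on all of ℝ, with (x(t),p(t)) → (x₀, 0) as t → −∞ and (x(t),p(t)) → (x₁, 0) as t → +∞, and suppose p(t*) ≠ 0 for some t* ∈ ℝ. Then h(x₀, 0) > h(x₁, 0). -/
open scoped RealInnerProductSpace

/-- If a `C²` function with positive definite Hessian is critical at the origin, its radial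
derivative is positive away from the origin. -/
theorem fderiv_apply_self_pos_of_hessian_pos {V : Type*} [NormedAddCommGroup V] [NormedSpace ℝ V]
    {f : V → ℝ} (hf : ContDiff ℝ 2 f)
    (hpos : ∀ p w : V, w ≠ 0 → 0 < iteratedFDeriv ℝ 2 f p ![w, w])
    (hcrit : fderiv ℝ f 0 = 0) {p : V} (hp : p ≠ 0) : 0 < fderiv ℝ f p p := by
  have hd : Differentiable ℝ (fderiv ℝ f) :=
    (hf.fderiv_right (m := 1) (by norm_num)).differentiable (by norm_num)
  have hline (s : ℝ) : HasDerivAt (fun s : ℝ => s • p) p s := by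
    simpa using (hasDerivAt_id s).smul_const p
  have hderiv (s : ℝ) : HasDerivAt (fun s : ℝ => fderiv ℝ f (s • p) p)
      (iteratedFDeriv ℝ 2 f (s • p) ![p, p]) s := by
    have hcomp : HasDerivAt (fun s : ℝ => fderiv ℝ f (s • p))
        (fderiv ℝ (fderiv ℝ f) (s • p) p) s :=
      (hd (s • p)).hasFDerivAt.comp_hasDerivAt s (hline s)
    have key := hcomp.clm_apply (hasDerivAt_const s p)
    rw [map_zero, add_zero] at key
    rw [iteratedFDeriv_two_apply]
    exact key
  have hmono : StrictMono fun s : ℝ => fderiv ℝ f (s • p) p :=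
    strictMono_of_deriv_pos fun s => by
      rw [(hderiv s).deriv]
      exact hpos _ _ hp
  simpa [hcrit] using hmono zero_lt_one

theorem fderiv_comp_prodMk_right {V W : Type*} [NormedAddCommGroup V] [NormedSpace ℝ V]
    [NormedAddCommGroup W] [NormedSpace ℝ W] {h : V × W → ℝ} {q : V × W}
    (hh : DifferentiableAt ℝ h q) (w : W) :
    fderiv ℝ (fun p => h (q.1, p)) q.2 w = fderiv ℝ h q (0, w) := by
  have key : HasFDerivAt (fun p => h (q.1, p)) _ q.2 :=
    HasFDerivAt.comp (x := q.2) (g := h) hh.hasFDerivAt (hasFDerivAt_prodMk_right q.1 q.2)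
  rw [key.fderiv]
  simp

theorem fderiv_comp_prodMk_left {V W : Type*} [NormedAddCommGroup V] [NormedSpace ℝ V]
    [NormedAddCommGroup W] [NormedSpace ℝ W] {h : V × W → ℝ} {q : V × W}
    (hh : DifferentiableAt ℝ h q) (v : V) :
    fderiv ℝ (fun x => h (x, q.2)) q.1 v = fderiv ℝ h q (v, 0) := by
  have key : HasFDerivAt (fun x => h (x, q.2)) _ q.1 :=
    HasFDerivAt.comp (x := q.1) (g := h) hh.hasFDerivAt (hasFDerivAt_prodMk_left q.1 q.2)
  rw [key.fderiv]
  simp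

theorem inner_gradient_eq_fderiv {V : Type*} [NormedAddCommGroup V] [InnerProductSpace ℝ V]
    [CompleteSpace V] (f : V → ℝ) (x v : V) : ⟪gradient f x, v⟫ = fderiv ℝ f x v := by
  simp [gradient]

theorem fderiv_apply_eq_inner_hgrad {n : ℕ}
    {h : EuclideanSpace ℝ (Fin n) × EuclideanSpace ℝ (Fin n) → ℝ}
    {q : EuclideanSpace ℝ (Fin n) × EuclideanSpace ℝ (Fin n)} (hh : DifferentiableAt ℝ h q)
    (v w : EuclideanSpace ℝ (Fin n)) :
    fderiv ℝ h q (v, w) = ⟪hgradX h q, v⟫ + ⟪hgradP h q, w⟫ := by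
  rw [hgradX, hgradP, inner_gradient_eq_fderiv, inner_gradient_eq_fderiv,
    fderiv_comp_prodMk_left hh, fderiv_comp_prodMk_right hh, ← map_add]
  simp

theorem inner_hgradP_self_pos {n : ℕ}
    {h : EuclideanSpace ℝ (Fin n) × EuclideanSpace ℝ (Fin n) → ℝ} (hh : ContDiff ℝ 2 h)
    {x : EuclideanSpace ℝ (Fin n)}
    (hpos : ∀ p w : EuclideanSpace ℝ (Fin n), w ≠ 0 →
      0 < iteratedFDeriv ℝ 2 (fun q => h (x, q)) p ![w, w])
    (hcrit : hgradP h (x, (0 : EuclideanSpace ℝ (Fin n))) = 0)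
    {p : EuclideanSpace ℝ (Fin n)} (hp : p ≠ 0) : 0 < ⟪hgradP h (x, p), p⟫ := by
  rw [hgradP, inner_gradient_eq_fderiv]
  have hf : ContDiff ℝ 2 fun q => h (x, q) := hh.comp (contDiff_prodMk_right x)
  refine fderiv_apply_self_pos_of_hessian_pos hf hpos ?_ hp
  simpa [hgradP, gradient] using hcrit

/-- Along a solution of the discounted system, the energy is dissipated at rate `lam * ⟪∂h/∂p, p⟫`. -/
theorem hasDerivAt_energy_discounted {n : ℕ}
    {h : EuclideanSpace ℝ (Fin n) × EuclideanSpace ℝ (Fin n) → ℝ} (hh : Differentiable ℝ h)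
    {lam : ℝ} {x p : ℝ → EuclideanSpace ℝ (Fin n)} {t : ℝ}
    (hx : HasDerivAt x (hgradP h (x t, p t)) t)
    (hp : HasDerivAt p (-hgradX h (x t, p t) - lam • p t) t) :
    HasDerivAt (fun t => h (x t, p t)) (-(lam * ⟪hgradP h (x t, p t), p t⟫)) t := by
  have key := (hh (x t, p t)).hasFDerivAt.comp_hasDerivAt t (hx.prodMk hp)
  refine key.congr_deriv ?_
  rw [fderiv_apply_eq_inner_hgrad (hh _), inner_sub_right, inner_neg_right, inner_smul_right,
    real_inner_comm]
  ring

theorem stmt_18 {n : ℕ} (hn : 1 ≤ n)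
    (h : EuclideanSpace ℝ (Fin n) × EuclideanSpace ℝ (Fin n) → ℝ) (hh : ContDiff ℝ 2 h)
    (hhess : ∀ (x p w : EuclideanSpace ℝ (Fin n)), w ≠ 0 →
      0 < iteratedFDeriv ℝ 2 (fun q => h (x, q)) p ![w, w])
    (hp0 : ∀ x : EuclideanSpace ℝ (Fin n), hgradP h (x, (0 : EuclideanSpace ℝ (Fin n))) = 0)
    (lam : ℝ) (hlam : 0 < lam)
    (x p : ℝ → EuclideanSpace ℝ (Fin n))
    (hsol : ∀ t : ℝ, HasDerivAt x (hgradP h (x t, p t)) t ∧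
      HasDerivAt p (-hgradX h (x t, p t) - lam • p t) t)
    (x₀ x₁ : EuclideanSpace ℝ (Fin n))
    (hlimm : Filter.Tendsto (fun t => (x t, p t)) Filter.atBot (nhds (x₀, (0 : EuclideanSpace ℝ (Fin n)))))
    (hlimp : Filter.Tendsto (fun t => (x t, p t)) Filter.atTop (nhds (x₁, (0 : EuclideanSpace ℝ (Fin n)))))
    (ts : ℝ) (hps : p ts ≠ 0) :
    h (x₁, (0 : EuclideanSpace ℝ (Fin n))) < h (x₀, (0 : EuclideanSpace ℝ (Fin n))) := by
  have hd : Differentiable ℝ h := hh.differentiable (by norm_num)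
  have hderiv (t : ℝ) : HasDerivAt (fun t => h (x t, p t))
      (-(lam * ⟪hgradP h (x t, p t), p t⟫)) t :=
    hasDerivAt_energy_discounted hd (hsol t).1 (hsol t).2
  have hanti : Antitone fun t => h (x t, p t) := by
    refine antitone_of_deriv_nonpos (fun t => (hderiv t).differentiableAt) fun t => ?_
    rw [(hderiv t).deriv, neg_nonpos]
    refine mul_nonneg hlam.le ?_
    by_cases hpt : p t = 0
    · simp [hpt]
    · exact (inner_hgradP_self_pos hh (hhess _) (hp0 _) hpt).le
  have hle (t : ℝ) : h (x t, p t) ≤ h (x₀, 0) :=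
    hanti.ge_of_tendsto ((hd.continuous.tendsto _).comp hlimm) t
  have hge (t : ℝ) : h (x₁, 0) ≤ h (x t, p t) :=
    hanti.le_of_tendsto ((hd.continuous.tendsto _).comp hlimp) t
  by_contra! hcon
  have hconst : (fun t => h (x t, p t)) = fun _ => h (x₀, 0) :=
    funext fun t => le_antisymm (hle t) (hcon.trans (hge t))
  have hzero := hderiv ts
  rw [hconst] at hzero
  have hrate := mul_pos hlam (inner_hgradP_self_pos hh (hhess _) (hp0 (x ts)) hps)
  linarith [hzero.unique (hasDerivAt_const ts (h (x₀, 0)))]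
end

section
/- Let H : E × E × ℝ → ℝ be C¹ with (∂H/∂u)(x,p,u) ≥ λ for some λ > 0 and all (x,p,u). Then there exists a unique function w : E × E → ℝ such that H(x, p, w(x,p)) = 0 for all (x,p) ∈ E × E; moreover w is continuous, the zero level set H⁻¹(0) equals the graph {(x,p,w(x,p)) : (x,p) ∈ E × E}, and the projection (x,p,u) ↦ (x,p) restricted to H⁻¹(0) is a homeomorphism onto E × E. -/
open scoped RealInnerProductSpace

/-- A uniformly strictly increasing family of continuous functions `ℝ → ℝ`, depending continuously
on a parameter, has a zero that depends continuously on the parameter. -/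
theorem exists_continuous_zero_of_mul_sub_le {X : Type*} [TopologicalSpace X] {F : X → ℝ → ℝ}
    (hF : Continuous fun y : X × ℝ => F y.1 y.2) {c : ℝ} (hc : 0 < c)
    (hmono : ∀ x a b, a ≤ b → c * (b - a) ≤ F x b - F x a) :
    ∃ w : X → ℝ, Continuous w ∧ ∀ x, F x (w x) = 0 := by
  have hzero : ∀ x, ∃ u, F x u = 0 := by
    intro x
    have hpos : 0 ≤ |F x 0| / c := by positivity
    have hmul : c * (|F x 0| / c) = |F x 0| := by field_simp
    refine mem_range_of_exists_le_of_exists_ge (f := F x)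
      (hF.comp (Continuous.prodMk_right x)) ⟨-(|F x 0| / c), ?_⟩ ⟨|F x 0| / c, ?_⟩
    · have h := hmono x (-(|F x 0| / c)) 0 (by linarith)
      rw [zero_sub, neg_neg, hmul] at h
      linarith [le_abs_self (F x 0)]
    · have h := hmono x 0 (|F x 0| / c) hpos
      rw [sub_zero, hmul] at h
      linarith [neg_abs_le (F x 0)]
  choose w hw using hzero
  have hdist : ∀ x u, |w x - u| ≤ |F x u| / c := by
    intro x u
    rw [le_div_iff₀' hc]
    rcases le_total u (w x) with h | h
    · have h1 := hmono x u (w x) h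
      rw [abs_of_nonneg (sub_nonneg.2 h)]
      linarith [neg_abs_le (F x u), hw x]
    · have h1 := hmono x (w x) u h
      rw [abs_sub_comm, abs_of_nonneg (sub_nonneg.2 h)]
      linarith [le_abs_self (F x u), hw x]
  refine ⟨w, continuous_iff_continuousAt.2 fun x₀ => ?_, hw⟩
  have hcont : Continuous fun x => |F x (w x₀)| / c :=
    ((hF.comp (Continuous.prodMk_left (w x₀))).abs).div_const c
  have hlim : Filter.Tendsto (fun x => |F x (w x₀)| / c) (nhds x₀) (nhds 0) := by
    simpa [hw x₀] using hcont.tendsto x₀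
  rw [ContinuousAt, tendsto_iff_dist_tendsto_zero]
  exact squeeze_zero (fun _ => dist_nonneg) (fun x => hdist x (w x₀)) hlim

theorem stmt_19 {n : ℕ} (hn : 1 ≤ n)
    (H : EuclideanSpace ℝ (Fin n) × EuclideanSpace ℝ (Fin n) × ℝ → ℝ) (hH : ContDiff ℝ 1 H)
    (lam : ℝ) (hlam : 0 < lam) (hmono : ∀ z, lam ≤ pderivU H z) :
    ∃ w : EuclideanSpace ℝ (Fin n) × EuclideanSpace ℝ (Fin n) → ℝ,
      (∀ q : EuclideanSpace ℝ (Fin n) × EuclideanSpace ℝ (Fin n), H (q.1, q.2, w q) = 0) ∧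
      (∀ w' : EuclideanSpace ℝ (Fin n) × EuclideanSpace ℝ (Fin n) → ℝ, (∀ q : EuclideanSpace ℝ (Fin n) × EuclideanSpace ℝ (Fin n), H (q.1, q.2, w' q) = 0) → w' = w) ∧
      Continuous w ∧
      {z : EuclideanSpace ℝ (Fin n) × EuclideanSpace ℝ (Fin n) × ℝ | H z = 0} = {z : EuclideanSpace ℝ (Fin n) × EuclideanSpace ℝ (Fin n) × ℝ | z.2.2 = w (z.1, z.2.1)} ∧
      IsHomeomorph (fun z : {z : EuclideanSpace ℝ (Fin n) × EuclideanSpace ℝ (Fin n) × ℝ // H z = 0} => (z.1.1, z.1.2.1)) := by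
  have hmono' : ∀ (q : EuclideanSpace ℝ (Fin n) × EuclideanSpace ℝ (Fin n)) (a b : ℝ),
      a ≤ b → lam * (b - a) ≤ H (q.1, q.2, b) - H (q.1, q.2, a) := by
    intro q a b hab
    have hdiff : Differentiable ℝ fun u : ℝ => H (q.1, q.2, u) :=
      (hH.differentiable one_ne_zero).comp (by fun_prop)
    exact mul_sub_le_image_sub_of_le_deriv hdiff (fun u => hmono (q.1, q.2, u)) hab
  obtain ⟨w, hwc, hw⟩ := exists_continuous_zero_of_mul_sub_le
    (F := fun (q : EuclideanSpace ℝ (Fin n) × EuclideanSpace ℝ (Fin n)) u => H (q.1, q.2, u))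
    (hH.continuous.comp (by fun_prop)) hlam hmono'
  have huniq : ∀ (q : EuclideanSpace ℝ (Fin n) × EuclideanSpace ℝ (Fin n)) (u : ℝ),
      H (q.1, q.2, u) = 0 → u = w q := by
    intro q u hu
    have hq := hw q
    rcases le_total u (w q) with h | h
    · have := hmono' q u (w q) h
      nlinarith
    · have := hmono' q (w q) u h
      nlinarith
  refine ⟨w, hw, fun w' hw' => funext fun q => huniq q _ (hw' q), hwc, ?_, ?_⟩
  · ext ⟨x, p, u⟩
    refine ⟨huniq (x, p) u, fun h => ?_⟩
    have h' : u = w (x, p) := h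
    rw [h']
    exact hw (x, p)
  · rw [isHomeomorph_iff_exists_inverse]
    refine ⟨by fun_prop, fun q => ⟨(q.1, q.2, w q), hw q⟩, ?_, fun _ => rfl, by fun_prop⟩
    rintro ⟨⟨x, p, u⟩, hz⟩
    exact Subtype.ext (congrArg (fun v => (x, p, v)) (huniq (x, p) u hz).symm)
end
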